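/- Let X_1,…,X_n be i.i.d. random variables taking values in a finite set 𝒳, and let Z be (ε, δ)-differentially private for X_{≤n}. Suppose 16·√(δ·max{ε^{−1}, 1}) ≤ 1, δ·max{ε^{−1}, 1}·log(1/(δ·max{ε^{−1}, 1})) ≤ ε², and δ·max{ε^{−1}, 1}·log²|𝒳| ≤ ε². Then I(X_{≤n}; Z) ≤ 9·n·ε. If additionally ε ≤ 1/6, δ ≤ ε⁵/(64·log²|𝒳|), and δ·log²(ε/δ) ≤ ε⁵/16, then I(X_{≤n}; Z) ≤ 75·n·ε². -/

import Mathlib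

open Finset

/-- `p` is a probability mass function on the finite type `Ω`. -/
def IsPMF {Ω : Type*} [Fintype Ω] (p : Ω → ℝ) : Prop :=
  (∀ ω, 0 ≤ p ω) ∧ ∑ ω, p ω = 1

/-- Shannon entropy (natural logarithm) of the pushforward of the pmf `p` along `f`. -/
noncomputable def ent {Ω A : Type*} [Fintype Ω] [Fintype A] [DecidableEq A]
    (p : Ω → ℝ) (f : Ω → A) : ℝ :=
  ∑ a, Real.negMulLog (∑ ω ∈ Finset.univ.filter (fun ω => f ω = a), p ω)

/-- Mutual information `I(f; g)` under the joint pmf `p`. -/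
noncomputable def mi {Ω A B : Type*} [Fintype Ω] [Fintype A] [DecidableEq A]
    [Fintype B] [DecidableEq B] (p : Ω → ℝ) (f : Ω → A) (g : Ω → B) : ℝ :=
  ent p f + ent p g - ent p fun ω => (f ω, g ω)

/-- Conditional mutual information `I(f; g | c)` under the joint pmf `p`. -/
noncomputable def condMI {Ω A B C : Type*} [Fintype Ω] [Fintype A] [DecidableEq A]
    [Fintype B] [DecidableEq B] [Fintype C] [DecidableEq C]
    (p : Ω → ℝ) (f : Ω → A) (g : Ω → B) (c : Ω → C) : ℝ :=
  ent p (fun ω => (f ω, c ω)) + ent p (fun ω => (g ω, c ω))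
    - ent p (fun ω => (f ω, g ω, c ω)) - ent p c

/-- Output distribution of the channel `W` with input distribution `P`. -/
noncomputable def channelOutput {A Z : Type*} [Fintype A] (P : A → ℝ) (W : A → Z → ℝ) (z : Z) : ℝ :=
  ∑ a, P a * W a z

/-- Shannon entropy of a mass function. -/
noncomputable def massEntropy {Z : Type*} [Fintype Z] (w : Z → ℝ) : ℝ :=
  ∑ z, Real.negMulLog (w z)

/-- Mutual information between input and output of the channel `W` with input distribution `P`. -/
noncomputable def channelInfo {A Z : Type*} [Fintype A] [Fintype Z] (P : A → ℝ) (W : A → Z → ℝ) : ℝ :=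
  massEntropy (channelOutput P W) - ∑ a, P a * massEntropy (W a)

theorem IsPMF.channelOutput {A Z : Type*} [Fintype A] [Fintype Z] {P : A → ℝ} {W : A → Z → ℝ}
    (hP : IsPMF P) (hW : ∀ a, IsPMF (W a)) : IsPMF (channelOutput P W) := by
  refine ⟨fun z => Finset.sum_nonneg fun a _ => mul_nonneg (hP.1 a) ((hW a).1 z), ?_⟩
  unfold _root_.channelOutput
  rw [Finset.sum_comm]
  simp [← Finset.mul_sum, (hW _).2, hP.2]

theorem IsPMF.le_one {A : Type*} [Fintype A] {P : A → ℝ} (hP : IsPMF P) (a : A) : P a ≤ 1 :=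
  hP.2 ▸ Finset.single_le_sum (fun b _ => hP.1 b) (Finset.mem_univ a)

theorem IsPMF.massEntropy_le_log_card {A : Type*} [Fintype A] {P : A → ℝ} (hP : IsPMF P) :
    massEntropy P ≤ Real.log (Fintype.card A) := by
  have hne : Nonempty A := by
    by_contra h
    rw [not_nonempty_iff] at h
    simpa using hP.2
  have hN : (0 : ℝ) < Fintype.card A := by exact_mod_cast Fintype.card_pos
  have key : ∀ a, Real.negMulLog (P a) ≤
      P a * Real.log (Fintype.card A) + ((Fintype.card A : ℝ)⁻¹ - P a) := by
    intro a
    rcases (hP.1 a).eq_or_lt with h | h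
    · simp [← h]
    · have := Real.log_le_sub_one_of_pos (inv_pos.2 (mul_pos h hN))
      rw [Real.log_inv, Real.log_mul h.ne' hN.ne'] at this
      have h' := mul_le_mul_of_nonneg_left this h.le
      have : P a * ((P a * (Fintype.card A : ℝ))⁻¹ - 1) = (Fintype.card A : ℝ)⁻¹ - P a := by
        field_simp
      rw [Real.negMulLog]
      linarith
  refine (Finset.sum_le_sum fun a _ => key a).trans ?_
  rw [Finset.sum_add_distrib, ← Finset.sum_mul, Finset.sum_sub_distrib, hP.2]
  simp [hN.ne']

theorem channelInfo_eq_sum {A Z : Type*} [Fintype A] [Fintype Z] (P : A → ℝ) (W : A → Z → ℝ) :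
    channelInfo P W =
      ∑ a, P a * ∑ z, W a z * (Real.log (W a z) - Real.log (channelOutput P W z)) := by
  have h : massEntropy (channelOutput P W) =
      ∑ a, P a * ∑ z, -(W a z * Real.log (channelOutput P W z)) := by
    simp only [Finset.mul_sum]
    rw [Finset.sum_comm]
    refine Finset.sum_congr rfl fun z _ => ?_
    rw [Real.negMulLog]
    nth_rewrite 1 [channelOutput]
    rw [← Finset.sum_neg_distrib, Finset.sum_mul]
    exact Finset.sum_congr rfl fun a _ => by ring
  rw [channelInfo, h, ← Finset.sum_sub_distrib]
  refine Finset.sum_congr rfl fun a _ => ?_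
  rw [massEntropy, ← mul_sub, ← Finset.sum_sub_distrib]
  congr 1
  exact Finset.sum_congr rfl fun z _ => by rw [Real.negMulLog]; ring

/-- If `u` is `(ε, δ)`-dominated by `v`, then `u` gives little mass to the points where
it exceeds `exp (2 * ε) * v`. -/
theorem sum_filter_exp_two_mul_lt_le {Z : Type*} [Fintype Z] {u v : Z → ℝ} {ε δ : ℝ}
    (hε : 0 < ε) (hδ : 0 ≤ δ)
    (h : ∀ S : Finset Z, ∑ z ∈ S, u z ≤ Real.exp ε * ∑ z ∈ S, v z + δ) :
    ∑ z, (if Real.exp (2 * ε) * v z < u z then u z else 0) ≤ 2 * (δ * max ε⁻¹ 1) := by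
  classical
  rw [← Finset.sum_filter]
  set S := Finset.univ.filter fun z => Real.exp (2 * ε) * v z < u z
  have hS := h S
  have h2 : Real.exp (2 * ε) * ∑ z ∈ S, v z ≤ ∑ z ∈ S, u z := by
    rw [Finset.mul_sum]
    exact Finset.sum_le_sum fun z hz => (Finset.mem_filter.1 hz).2.le
  have hexp : Real.exp (2 * ε) = Real.exp ε * Real.exp ε := by rw [two_mul, Real.exp_add]
  rw [hexp] at h2
  have he : ε + 1 ≤ Real.exp ε := Real.add_one_le_exp ε
  have hm := mul_le_mul_of_nonneg_left hS (Real.exp_pos ε).le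
  have hs : (Real.exp ε - 1) * (∑ z ∈ S, u z - δ) ≤ δ := by nlinarith
  have hle : ∑ z ∈ S, u z - δ ≤ δ * ε⁻¹ := by
    by_cases hc : ∑ z ∈ S, u z - δ ≤ 0
    · exact hc.trans (by positivity)
    · rw [← div_eq_mul_inv, le_div_iff₀ hε]
      nlinarith
  have := mul_le_mul_of_nonneg_left (le_max_left ε⁻¹ 1) hδ
  have := mul_le_mul_of_nonneg_left (le_max_right ε⁻¹ 1) hδ
  linarith

theorem mul_log_sub_log_le_neg_log {w v m : ℝ} (hw : 0 ≤ w) (hm : 0 < m) (hmw : m * w ≤ v) :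
    w * (Real.log w - Real.log v) ≤ w * -Real.log m := by
  rcases hw.eq_or_lt with rfl | hw
  · simp
  · have := Real.log_le_log (by positivity) hmw
    rw [Real.log_mul hm.ne' hw.ne'] at this
    exact mul_le_mul_of_nonneg_left (by linarith) hw.le

theorem mul_log_sub_log_le_linear {w v m ε : ℝ} (hw : 0 ≤ w) (hε : 0 < ε) (hm : 0 < m)
    (hmw : m * w ≤ v) :
    w * (Real.log w - Real.log v) ≤
      2 * ε * w + (if Real.exp (2 * ε) * v < w then w else 0) * -Real.log m := by
  split_ifs with h
  · have := mul_log_sub_log_le_neg_log hw hm hmw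
    nlinarith
  · rcases hw.eq_or_lt with rfl | hw
    · simp
    · have hv : 0 < v := (mul_pos hm hw).trans_le hmw
      have := Real.log_le_log hw (not_lt.1 h)
      rw [Real.log_mul (Real.exp_pos _).ne' hv.ne', Real.log_exp] at this
      nlinarith

theorem mul_log_sub_log_le_quadratic {w v m ε : ℝ} (hw : 0 ≤ w) (hε : 0 < ε) (hε' : ε ≤ 1 / 6)
    (hm : 0 < m) (hmw : m * w ≤ v) :
    w * (Real.log w - Real.log v) ≤
      (w - v) + 9 * ε ^ 2 * v + (if Real.exp (2 * ε) * w < v then v else 0) +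
        (if Real.exp (2 * ε) * v < w then w else 0) * -Real.log m := by
  have hv : 0 ≤ v := (mul_nonneg hm.le hw).trans hmw
  have hE : 1 ≤ Real.exp (2 * ε) := Real.one_le_exp (by positivity)
  have hq : 0 ≤ 9 * ε ^ 2 * v := by positivity
  by_cases h1 : Real.exp (2 * ε) * w < v
  · have hwv : w ≤ v := by nlinarith
    have h2 : ¬ Real.exp (2 * ε) * v < w := by nlinarith
    simp only [h1, h2, if_true, if_false]
    rcases hw.eq_or_lt with rfl | hw
    · simp; linarith
    · have := Real.log_le_log hw hwv
      nlinarith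
  by_cases h2 : Real.exp (2 * ε) * v < w
  · have hwv : v ≤ w := by nlinarith
    simp only [h1, h2, if_true, if_false]
    have := mul_log_sub_log_le_neg_log hw hm hmw
    linarith
  simp only [h1, h2, if_false]
  push Not at h1 h2
  rcases hw.eq_or_lt with rfl | hw
  · have : v = 0 := by nlinarith
    simp [this]
  have hv : 0 < v := (mul_pos hm hw).trans_le hmw
  have hE3 : Real.exp (2 * ε) - 1 ≤ 3 * ε := by
    have := Real.exp_bound_div_one_sub_of_interval (x := 2 * ε) (by positivity) (by linarith)
    have h3 : 1 / (1 - 2 * ε) ≤ 1 + 3 * ε := by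
      rw [div_le_iff₀ (by linarith)]
      nlinarith
    linarith
  have hup : w - v ≤ 3 * ε * v := by nlinarith
  have hlow : v - w ≤ 3 * ε * v := by
    rcases le_total w v with h | h
    · nlinarith [mul_le_mul_of_nonneg_right hE3 hw.le]
    · nlinarith
  have hsq : (w - v) ^ 2 ≤ (3 * ε * v) ^ 2 := sq_le_sq' (by linarith) hup
  have hlog := Real.log_le_sub_one_of_pos (div_pos hw hv)
  rw [Real.log_div hw.ne' hv.ne'] at hlog
  have h4 := mul_le_mul_of_nonneg_left hlog hw.le
  have h5 : w * (w / v - 1) = (w - v) + (w - v) ^ 2 / v := by field_simp; ring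
  have h6 : (w - v) ^ 2 / v ≤ 9 * ε ^ 2 * v := by
    rw [div_le_iff₀ hv]
    linarith
  linarith

theorem sum_channelOutput {A Z : Type*} [Fintype A] {P : A → ℝ} {W : A → Z → ℝ}
    (S : Finset Z) :
    ∑ z ∈ S, channelOutput P W z = ∑ a, P a * ∑ z ∈ S, W a z := by
  simp only [channelOutput, Finset.mul_sum]
  exact Finset.sum_comm

section SingleLetter

variable {A Z : Type*} [Fintype A] {P : A → ℝ} {W : A → Z → ℝ} {ε δ : ℝ}

theorem sum_le_exp_mul_sum_channelOutput (hP : IsPMF P)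
    (hDP : ∀ (S : Finset Z) (a b : A), ∑ z ∈ S, W a z ≤ Real.exp ε * ∑ z ∈ S, W b z + δ)
    (a : A) (S : Finset Z) :
    ∑ z ∈ S, W a z ≤ Real.exp ε * ∑ z ∈ S, channelOutput P W z + δ := by
  have h := Finset.sum_le_sum fun b (_ : b ∈ Finset.univ) =>
    mul_le_mul_of_nonneg_left (hDP S a b) (hP.1 b)
  simp only [mul_add, Finset.sum_add_distrib, ← Finset.sum_mul, hP.2, mul_left_comm (P _),
    ← Finset.mul_sum, one_mul] at h
  rwa [sum_channelOutput]

theorem sum_channelOutput_le_exp_mul_sum (hP : IsPMF P)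
    (hDP : ∀ (S : Finset Z) (a b : A), ∑ z ∈ S, W a z ≤ Real.exp ε * ∑ z ∈ S, W b z + δ)
    (a : A) (S : Finset Z) :
    ∑ z ∈ S, channelOutput P W z ≤ Real.exp ε * ∑ z ∈ S, W a z + δ := by
  have h := Finset.sum_le_sum fun b (_ : b ∈ Finset.univ) =>
    mul_le_mul_of_nonneg_left (hDP S b a) (hP.1 b)
  rwa [← sum_channelOutput, ← Finset.sum_mul, hP.2, one_mul] at h

variable [Fintype Z]

theorem mul_le_channelOutput (hP : IsPMF P) (hW : ∀ a, IsPMF (W a)) (a : A) (z : Z) :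
    P a * W a z ≤ channelOutput P W z :=
  Finset.single_le_sum (f := fun a => P a * W a z)
    (fun b _ => mul_nonneg (hP.1 b) ((hW b).1 z)) (Finset.mem_univ a)

theorem channelInfo_le_of_sum_le {c η : ℝ} (hP : IsPMF P) (hη : 0 ≤ η)
    (h : ∀ a, 0 < P a → ∑ z, W a z * (Real.log (W a z) - Real.log (channelOutput P W z)) ≤
      c + η * -Real.log (P a)) :
    channelInfo P W ≤ c + η * Real.log (Fintype.card A) := by
  rw [channelInfo_eq_sum]
  calc _ ≤ ∑ a, (P a * c + η * Real.negMulLog (P a)) := by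
        refine Finset.sum_le_sum fun a _ => ?_
        rcases (hP.1 a).eq_or_lt with h0 | h0
        · simp [← h0]
        · refine (mul_le_mul_of_nonneg_left (h a h0) h0.le).trans (le_of_eq ?_)
          rw [Real.negMulLog]; ring
    _ = c + η * massEntropy P := by
        rw [Finset.sum_add_distrib, ← Finset.sum_mul, hP.2, ← Finset.mul_sum, one_mul, massEntropy]
    _ ≤ _ := by
        gcongr
        exact hP.massEntropy_le_log_card

theorem channelInfo_le_linear (hP : IsPMF P) (hW : ∀ a, IsPMF (W a)) (hε : 0 < ε) (hδ : 0 ≤ δ)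
    (hDP : ∀ (S : Finset Z) (a b : A), ∑ z ∈ S, W a z ≤ Real.exp ε * ∑ z ∈ S, W b z + δ) :
    channelInfo P W ≤ 2 * ε + 2 * (δ * max ε⁻¹ 1) * Real.log (Fintype.card A) := by
  refine channelInfo_le_of_sum_le hP (by positivity) fun a ha => ?_
  refine (Finset.sum_le_sum fun z _ => mul_log_sub_log_le_linear ((hW a).1 z) hε ha
    (mul_le_channelOutput hP hW a z)).trans ?_
  rw [Finset.sum_add_distrib, ← Finset.mul_sum, (hW a).2, ← Finset.sum_mul, mul_one]
  have := Real.log_nonpos ha.le (hP.le_one a)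
  gcongr
  · linarith
  · exact sum_filter_exp_two_mul_lt_le hε hδ (sum_le_exp_mul_sum_channelOutput hP hDP a)

theorem channelInfo_le_quadratic (hP : IsPMF P) (hW : ∀ a, IsPMF (W a)) (hε : 0 < ε)
    (hε' : ε ≤ 1 / 6) (hδ : 0 ≤ δ)
    (hDP : ∀ (S : Finset Z) (a b : A), ∑ z ∈ S, W a z ≤ Real.exp ε * ∑ z ∈ S, W b z + δ) :
    channelInfo P W ≤ 9 * ε ^ 2 + 2 * (δ * max ε⁻¹ 1) +
      2 * (δ * max ε⁻¹ 1) * Real.log (Fintype.card A) := by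
  refine channelInfo_le_of_sum_le hP (by positivity) fun a ha => ?_
  refine (Finset.sum_le_sum fun z _ => mul_log_sub_log_le_quadratic ((hW a).1 z) hε hε' ha
    (mul_le_channelOutput hP hW a z)).trans ?_
  rw [Finset.sum_add_distrib, Finset.sum_add_distrib, Finset.sum_add_distrib,
    Finset.sum_sub_distrib, ← Finset.mul_sum, (hW a).2, (hP.channelOutput hW).2,
    ← Finset.sum_mul, mul_one, sub_self, zero_add]
  have := Real.log_nonpos ha.le (hP.le_one a)
  gcongr
  · exact sum_filter_exp_two_mul_lt_le hε hδ (sum_channelOutput_le_exp_mul_sum hP hDP a)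
  · linarith
  · exact sum_filter_exp_two_mul_lt_le hε hδ (sum_le_exp_mul_sum_channelOutput hP hDP a)

end SingleLetter

theorem sum_fin_succ_pi {A : Type*} [Fintype A] {n : ℕ} (f : (Fin (n + 1) → A) → ℝ) :
    ∑ x, f x = ∑ a, ∑ y, f (Fin.cons a y) := by
  rw [← Fintype.sum_prod_type']
  exact (Equiv.sum_comp (Fin.consEquiv fun _ : Fin (n + 1) => A) f).symm

theorem IsPMF.pi {A : Type*} [Fintype A] {P : A → ℝ} (hP : IsPMF P) (n : ℕ) :
    IsPMF fun x : Fin n → A => ∏ i, P (x i) := by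
  refine ⟨fun x => Finset.prod_nonneg fun i _ => hP.1 _, ?_⟩
  induction n with
  | zero => simp
  | succ n ih =>
    rw [sum_fin_succ_pi]
    simp [Fin.prod_univ_succ, ← Finset.mul_sum, ih, hP.2]

/-- Tensorization: a bound on the information about a single entry yields a bound on the
information about an i.i.d. sample. -/
theorem channelInfo_pi_le {A Z : Type*} [Fintype A] [Fintype Z] {P : A → ℝ} (hP : IsPMF P)
    {ε δ C : ℝ}
    (hC : ∀ W : A → Z → ℝ, (∀ a, IsPMF (W a)) →
      (∀ (S : Finset Z) (a b : A), ∑ z ∈ S, W a z ≤ Real.exp ε * ∑ z ∈ S, W b z + δ) →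
      channelInfo P W ≤ C)
    (n : ℕ) (T : (Fin n → A) → Z → ℝ) (hT : ∀ x, IsPMF (T x))
    (hDP : ∀ (S : Finset Z) (x x' : Fin n → A) (i : Fin n), (∀ j, j ≠ i → x j = x' j) →
      ∑ z ∈ S, T x z ≤ Real.exp ε * ∑ z ∈ S, T x' z + δ) :
    channelInfo (fun x : Fin n → A => ∏ i, P (x i)) T ≤ n * C := by
  induction n with
  | zero =>
    have : channelOutput (fun x : Fin 0 → A => ∏ i, P (x i)) T = T default := by
      funext z
      simp [channelOutput]
    rw [channelInfo, this]
    simp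
  | succ n ih =>
    set Q : (Fin n → A) → ℝ := fun y => ∏ i, P (y i)
    have hQ : IsPMF Q := hP.pi n
    set V : A → Z → ℝ := fun a => channelOutput Q fun y => T (Fin.cons a y)
    have hV : ∀ a, IsPMF (V a) := fun a => hQ.channelOutput fun y => hT _
    have hhead : channelInfo P V ≤ C := by
      refine hC V hV fun S a b => ?_
      simp only [V, sum_channelOutput]
      have h := Finset.sum_le_sum fun y (_ : y ∈ Finset.univ) => mul_le_mul_of_nonneg_left
        (hDP S (Fin.cons a y) (Fin.cons b y) 0 fun j hj => by
          obtain ⟨k, rfl⟩ := Fin.exists_succ_eq.2 hj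
          simp) (hQ.1 y)
      simpa only [mul_add, Finset.sum_add_distrib, ← Finset.sum_mul, hQ.2, mul_left_comm (Q _),
        ← Finset.mul_sum, one_mul] using h
    have htail : ∀ a, channelInfo Q (fun y => T (Fin.cons a y)) ≤ n * C := fun a =>
      ih _ (fun y => hT _) fun S y y' i hy => hDP S _ _ i.succ fun j hj => by
        rcases Fin.eq_zero_or_eq_succ j with rfl | ⟨k, rfl⟩
        · simp
        · simpa using hy k fun h => hj (h ▸ rfl)
    have hchain : channelInfo (fun x : Fin (n + 1) → A => ∏ i, P (x i)) T =
        channelInfo P V + ∑ a, P a * channelInfo Q (fun y => T (Fin.cons a y)) := by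
      have hout : channelOutput (fun x : Fin (n + 1) → A => ∏ i, P (x i)) T =
          channelOutput P V := by
        funext z
        simp only [channelOutput, V, Q, sum_fin_succ_pi, Fin.prod_univ_succ, Fin.cons_zero,
          Fin.cons_succ, Finset.mul_sum, mul_assoc]
      rw [channelInfo, hout]
      simp only [channelInfo, mul_sub, Finset.sum_sub_distrib, V, Q, sum_fin_succ_pi,
        Fin.prod_univ_succ, Fin.cons_zero, Fin.cons_succ, Finset.mul_sum, mul_assoc]
      ring
    have hsum : ∑ a, P a * channelInfo Q (fun y => T (Fin.cons a y)) ≤ n * C := by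
      refine (Finset.sum_le_sum fun a _ =>
        mul_le_mul_of_nonneg_left (htail a) (hP.1 a)).trans (le_of_eq ?_)
      rw [← Finset.sum_mul, hP.2, one_mul]
    rw [hchain]
    push_cast
    linarith

theorem mi_eq_channelInfo {A Z : Type*} [Fintype A] [DecidableEq A] [Fintype Z] [DecidableEq Z]
    {P : A → ℝ} {W : A → Z → ℝ} (hW : ∀ a, IsPMF (W a)) {joint : A × Z → ℝ}
    (hjoint : ∀ ω, joint ω = P ω.1 * W ω.1 ω.2) :
    mi joint (fun ω => ω.1) (fun ω => ω.2) = channelInfo P W := by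
  have h1 : ent joint (fun ω => ω.1) = massEntropy P := by
    refine Finset.sum_congr rfl fun a _ => ?_
    congr 1
    rw [Finset.sum_filter, Fintype.sum_prod_type, Finset.sum_eq_single a]
    · simp [hjoint, ← Finset.mul_sum, (hW a).2]
    · intro b _ hb
      simp [hb]
    · simp
  have h2 : ent joint (fun ω => ω.2) = massEntropy (channelOutput P W) := by
    refine Finset.sum_congr rfl fun z _ => ?_
    congr 1
    rw [Finset.sum_filter, Fintype.sum_prod_type]
    simp [hjoint, channelOutput]
  have h3 : ent joint (fun ω => (ω.1, ω.2)) = massEntropy P + ∑ a, P a * massEntropy (W a) := by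
    have : ent joint (fun ω => (ω.1, ω.2)) = ∑ ω, Real.negMulLog (joint ω) := by
      refine Finset.sum_congr rfl fun ω _ => ?_
      congr 1
      simp [Finset.sum_filter]
    rw [this, Fintype.sum_prod_type, massEntropy, ← Finset.sum_add_distrib]
    refine Finset.sum_congr rfl fun a _ => ?_
    simp only [hjoint, Real.negMulLog_mul, Finset.sum_add_distrib, ← Finset.sum_mul, (hW a).2,
      ← Finset.mul_sum, one_mul, massEntropy]
  rw [mi, h1, h2, h3, channelInfo]
  ring

/-- simplified mutual information bounds for `(ε, δ)`-differentially
private outputs of i.i.d. data on a finite set `X0`. -/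
theorem eps_delta_information_bound_simplified
    (n : ℕ) (hn : 1 ≤ n)
    (X0 ZT : Type) [Fintype X0] [DecidableEq X0] [Fintype ZT] [DecidableEq ZT]
    (μ : X0 → ℝ) (hμ : IsPMF μ)
    (trans : (Fin n → X0) → ZT → ℝ) (htrans : ∀ x, IsPMF (trans x))
    (ε δ : ℝ) (hε : 0 < ε) (hδ0 : 0 ≤ δ)
    (hDP : ∀ (S : Finset ZT) (x x' : Fin n → X0) (i : Fin n),
      (∀ j, j ≠ i → x j = x' j) →
      ∑ z ∈ S, trans x z ≤ Real.exp ε * ∑ z ∈ S, trans x' z + δ)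
    (h1 : 16 * Real.sqrt (δ * max ε⁻¹ 1) ≤ 1)
    (h2 : δ * max ε⁻¹ 1 * Real.log (1 / (δ * max ε⁻¹ 1)) ≤ ε ^ 2)
    (h3 : δ * max ε⁻¹ 1 * (Real.log (Fintype.card X0)) ^ 2 ≤ ε ^ 2)
    (joint : (Fin n → X0) × ZT → ℝ)
    (hjoint : ∀ ω, joint ω = (∏ i, μ (ω.1 i)) * trans ω.1 ω.2) :
    mi joint (fun ω => ω.1) (fun ω => ω.2) ≤ 9 * n * ε ∧
    (ε ≤ 1 / 6 → δ ≤ ε ^ 5 / (64 * (Real.log (Fintype.card X0)) ^ 2) →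
      δ * (Real.log (ε / δ)) ^ 2 ≤ ε ^ 5 / 16 →
      mi joint (fun ω => ω.1) (fun ω => ω.2) ≤ 75 * n * ε ^ 2) := by
  have hmi := mi_eq_channelInfo (P := fun x : Fin n → X0 => ∏ i, μ (x i)) htrans hjoint
  rw [hmi]
  set L := Real.log (Fintype.card X0) with hL
  set η := δ * max ε⁻¹ 1 with hη
  have hη0 : 0 ≤ η := by positivity
  have hL0 : 0 ≤ L := Real.log_natCast_nonneg _
  constructor
  · refine (channelInfo_pi_le hμ (C := 9 * ε) (fun W hW hDPW => ?_) n trans htrans hDP).trans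
      (le_of_eq (by ring))
    refine (channelInfo_le_linear hμ hW hε hδ0 hDPW).trans ?_
    rw [← hL, ← hη]
    have hs0 := Real.sqrt_nonneg η
    have hss := Real.sq_sqrt hη0
    have hsL : Real.sqrt η * L ≤ ε := by
      refine le_of_sq_le_sq ?_ hε.le
      rw [mul_pow, hss]
      exact h3
    nlinarith
  · intro hε6 hδL _
    refine (channelInfo_pi_le hμ (C := 75 * ε ^ 2) (fun W hW hDPW => ?_) n trans htrans
      hDP).trans (le_of_eq (by ring))
    refine (channelInfo_le_quadratic hμ hW hε hε6 hδ0 hDPW).trans ?_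
    rw [← hL, ← hη]
    rcases le_or_gt (Fintype.card X0) 1 with hc | hc
    · have hL1 : L = 0 := le_antisymm
        (Real.log_nonpos (Nat.cast_nonneg _) (by exact_mod_cast hc)) hL0
      have hδ1 : δ = 0 := le_antisymm (by simpa [hL1] using hδL) hδ0
      simp only [hη, hδ1, hL1]
      nlinarith
    · have hL2 : 1 / 2 ≤ L := by
        have h2c : (2 : ℝ) ≤ Fintype.card X0 := by exact_mod_cast hc
        have := Real.log_le_log two_pos h2c
        linarith [Real.log_two_gt_d9]
      have hηL : η * L ≤ 2 * (η * L ^ 2) := by nlinarith [mul_nonneg hη0 hL0]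
      nlinarith
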